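/- arXiv:1306.4619 — 2 statements merged into one kernel-verified Lean document; each statement's English description precedes it below -/
import Mathlib

section
/- For every q > 0, the equation ψ(λ) = q has exactly n+2 solutions θ₁ > θ₂ > ... > θ_{n+2} in ℝ ∖ {−α₁, ..., −αₙ}, and these solutions interlace with the poles of ψ: θ_{n+2} < −αₙ < θ_{n+1} < −α_{n−1} < θₙ < ... < θ₃ < −α₁ < θ₂ < θ₁, with θ₁ > 0. -/
open MeasureTheory Set Filter Topology

/-- The Laplace exponent of a jump-diffusion with Brownian part and compound Poisson jumps
whose distribution is a mixture of `n` exponentials: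
`ψ(λ) = cλ + (σ²/2)λ² + η ( Σᵢ aᵢαᵢ/(λ+αᵢ) - 1 )`. -/
noncomputable def mixExpPsi (n : ℕ) (c σ η : ℝ) (a α : Fin n → ℝ) (l : ℝ) : ℝ :=
  c * l + σ ^ 2 / 2 * l ^ 2 + η * ((∑ i, a i * α i / (l + α i)) - 1)

theorem mixExpPsi_zero {n : ℕ} {c σ η : ℝ} {a α : Fin n → ℝ}
    (hα : ∀ i, 0 < α i) (hasum : ∑ i, a i = 1) : mixExpPsi n c σ η a α 0 = 0 := by
  have h : ∑ i, a i * α i / (0 + α i) = 1 := by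
    rw [← hasum]
    exact Finset.sum_congr rfl fun i _ => by rw [zero_add, mul_div_cancel_right₀ _ (hα i).ne']
  rw [mixExpPsi, h]
  ring

theorem continuousOn_mixExpPsi {n : ℕ} (c σ η : ℝ) (a α : Fin n → ℝ) :
    ContinuousOn (mixExpPsi n c σ η a α) {l | ∀ j, l ≠ -α j} := by
  unfold mixExpPsi
  refine ContinuousOn.add (by fun_prop) (continuousOn_const.mul (ContinuousOn.sub
    (continuousOn_finsetSum _ fun i _ => ContinuousOn.div (by fun_prop) (by fun_prop)
      fun l hl h => hl i (by linarith)) continuousOn_const))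

/-- Near a pole, `mixExpPsi` is the polar part plus a function continuous at the pole. -/
theorem mixExpPsi_eq_polar_add {n : ℕ} (c σ η : ℝ) (a : Fin n → ℝ) {α : Fin n → ℝ}
    (hα : Function.Injective α) (i : Fin n) :
    ∃ g : ℝ → ℝ, ContinuousAt g (-α i) ∧
      mixExpPsi n c σ η a α = fun l => η * (a i * α i) * (l + α i)⁻¹ + g l := by
  refine ⟨fun l => c * l + σ ^ 2 / 2 * l ^ 2 +
    η * ((∑ j ∈ Finset.univ.erase i, a j * α j / (l + α j)) - 1), ?_, ?_⟩
  · refine ContinuousAt.add (by fun_prop) (continuousAt_const.mul (ContinuousAt.sub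
      (tendsto_finsetSum _ fun j hj => ContinuousAt.div (by fun_prop) (by fun_prop)
        fun h => ?_) continuousAt_const))
    exact Finset.ne_of_mem_erase hj (hα (by linarith))
  · funext l
    rw [mixExpPsi, ← Finset.add_sum_erase _ _ (Finset.mem_univ i)]
    ring

theorem tendsto_mixExpPsi_nhdsGT {n : ℕ} (c σ : ℝ) {η : ℝ} {a α : Fin n → ℝ}
    (hα : Function.Injective α) (hη : 0 < η) {i : Fin n} (hi : 0 < a i * α i) :
    Tendsto (mixExpPsi n c σ η a α) (𝓝[>] (-α i)) atTop := by
  obtain ⟨g, hg, h⟩ := mixExpPsi_eq_polar_add c σ η a hα i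
  rw [h]
  refine Tendsto.atTop_add (Tendsto.const_mul_atTop (mul_pos hη hi)
    (tendsto_inv_nhdsGT_zero.comp ?_)) (hg.tendsto.mono_left nhdsWithin_le_nhds)
  refine tendsto_nhdsWithin_of_tendsto_nhds_of_eventually_within _ ?_ ?_
  · have : ContinuousAt (fun l => l + α i) (-α i) := by fun_prop
    simpa [ContinuousAt] using this.mono_left nhdsWithin_le_nhds
  · filter_upwards [self_mem_nhdsWithin] with l hl
    exact neg_lt_iff_pos_add.mp (mem_Ioi.mp hl)

theorem tendsto_mixExpPsi_nhdsLT {n : ℕ} (c σ : ℝ) {η : ℝ} {a α : Fin n → ℝ}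
    (hα : Function.Injective α) (hη : 0 < η) {i : Fin n} (hi : 0 < a i * α i) :
    Tendsto (mixExpPsi n c σ η a α) (𝓝[<] (-α i)) atBot := by
  obtain ⟨g, hg, h⟩ := mixExpPsi_eq_polar_add c σ η a hα i
  rw [h]
  refine Tendsto.atBot_add (Tendsto.const_mul_atBot (mul_pos hη hi)
    (tendsto_inv_nhdsLT_zero.comp ?_)) (hg.tendsto.mono_left nhdsWithin_le_nhds)
  refine tendsto_nhdsWithin_of_tendsto_nhds_of_eventually_within _ ?_ ?_
  · have : ContinuousAt (fun l => l + α i) (-α i) := by fun_prop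
    simpa [ContinuousAt] using this.mono_left nhdsWithin_le_nhds
  · filter_upwards [self_mem_nhdsWithin] with l hl
    exact lt_neg_iff_add_neg.mp (mem_Iio.mp hl)

theorem tendsto_mixExpPsi_atTop {n : ℕ} (c : ℝ) {σ : ℝ} (η : ℝ) (a α : Fin n → ℝ)
    (hσ : 0 < σ) : Tendsto (mixExpPsi n c σ η a α) atTop atTop := by
  have hquad : Tendsto (fun l : ℝ => c * l + σ ^ 2 / 2 * l ^ 2) atTop atTop := by
    have : Tendsto (fun l : ℝ => l * (c + σ ^ 2 / 2 * l)) atTop atTop :=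
      tendsto_id.atTop_mul_atTop₀ (tendsto_atTop_add_const_left _ c
        (tendsto_id.const_mul_atTop (by positivity)))
    exact this.congr fun l => by ring
  refine hquad.atTop_add (C := η * ((∑ _i : Fin n, 0) - 1)) (Tendsto.const_mul _ (Tendsto.sub_const
    (tendsto_finsetSum _ fun i _ => ?_) _))
  exact (tendsto_atTop_add_const_right _ (α i) tendsto_id).const_div_atTop _

/-- The reflection `l ↦ -l` turns `mixExpPsi` into the same expression with parameters negated. -/
theorem mixExpPsi_neg {n : ℕ} (c σ η : ℝ) (a α : Fin n → ℝ) (l : ℝ) :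
    mixExpPsi n c σ η a α (-l) = mixExpPsi n (-c) σ η a (fun i => -α i) l := by
  have h : ∀ i, a i * α i / (-l + α i) = a i * -α i / (l + -α i) := fun i => by
    rw [← neg_div_neg_eq]
    congr 1 <;> ring
  simp only [mixExpPsi, h]
  ring

theorem tendsto_mixExpPsi_atBot {n : ℕ} (c : ℝ) {σ : ℝ} (η : ℝ) (a α : Fin n → ℝ)
    (hσ : 0 < σ) : Tendsto (mixExpPsi n c σ η a α) atBot atTop := by
  refine ((tendsto_mixExpPsi_atTop (-c) η a (fun i => -α i) hσ).comp
    tendsto_neg_atBot_atTop).congr fun l => ?_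
  rw [Function.comp_apply, ← mixExpPsi_neg, neg_neg]

/-- In each of the `n + 1` intervals cut out of `(-∞, 0)` by the poles, `ψ` takes the value `q`. -/
theorem exists_neg_root_mixExpPsi_between {n : ℕ} (c : ℝ) {σ η q : ℝ} {a α : Fin n → ℝ}
    (hαpos : ∀ i, 0 < α i) (hα : StrictMono α) (hapos : ∀ i, 0 < a i) (hasum : ∑ i, a i = 1)
    (hη : 0 < η) (hσ : 0 < σ) (hq : 0 < q) {k : ℕ} (hk : k ≤ n) :
    ∃ x < 0, mixExpPsi n c σ η a α x = q ∧
      ∀ j : Fin n, ((j : ℕ) < k → x < -α j) ∧ (k ≤ j → -α j < x) := by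
  have hpole : ∀ i, 0 < a i * α i := fun i => mul_pos (hapos i) (hαpos i)
  obtain ⟨v, hv0, hvq, hv⟩ : ∃ v ≤ 0, mixExpPsi n c σ η a α v < q ∧
      ∀ j : Fin n, ((j : ℕ) < k → v < -α j) ∧ (k ≤ j → -α j < v) := by
    rcases k with _ | m
    · exact ⟨0, le_rfl, by rwa [mixExpPsi_zero hαpos hasum],
        fun j => ⟨fun h => absurd h (Nat.not_lt_zero _), fun _ => neg_lt_zero.mpr (hαpos j)⟩⟩
    · let i : Fin n := ⟨m, hk⟩
      have hge : ∀ᶠ x in 𝓝[<] (-α i), ∀ j : Fin n, m + 1 ≤ j → -α j < x := by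
        refine eventually_all.mpr fun j => ?_
        by_cases hj : m + 1 ≤ j
        · have hij : -α j < -α i := neg_lt_neg (hα (Fin.lt_def.mpr hj))
          filter_upwards [nhdsWithin_le_nhds (lt_mem_nhds hij)] with x hx _ using hx
        · exact Eventually.of_forall fun x h => absurd h hj
      obtain ⟨v, ⟨hvq, hvj⟩, hvi⟩ := (((tendsto_mixExpPsi_nhdsLT c σ hα.injective hη
        (hpole i)).eventually_lt_atBot q |>.and hge).and self_mem_nhdsWithin).exists
      have hvi : v < -α i := hvi
      refine ⟨v, by linarith [hαpos i], hvq, fun j => ⟨fun hj => hvi.trans_le ?_, hvj j⟩⟩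
      exact neg_le_neg (hα.monotone (Fin.le_def.mpr (Nat.lt_succ_iff.mp hj)))
  obtain ⟨u, huv, huq, hu⟩ : ∃ u < v, q < mixExpPsi n c σ η a α u ∧
      ∀ j : Fin n, k ≤ j → -α j < u := by
    rcases hk.lt_or_eq with hkn | rfl
    · let i : Fin n := ⟨k, hkn⟩
      obtain ⟨u, ⟨huq, huv⟩, hui⟩ := (((tendsto_mixExpPsi_nhdsGT c σ hα.injective hη
        (hpole i)).eventually_gt_atTop q |>.and
          (nhdsWithin_le_nhds (gt_mem_nhds ((hv i).2 le_rfl)))).and self_mem_nhdsWithin).exists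
      have hui : -α i < u := hui
      exact ⟨u, huv, huq, fun j hj =>
        (neg_le_neg (hα.monotone (Fin.le_def.mpr hj))).trans_lt hui⟩
    · obtain ⟨u, huq, huv⟩ := ((tendsto_mixExpPsi_atBot c η a α hσ).eventually_gt_atTop q |>.and
        (eventually_lt_atBot v)).exists
      exact ⟨u, huv, huq, fun j hj => absurd hj (not_le.mpr j.2)⟩
  have hbetween : ∀ x ∈ Icc u v, ∀ j : Fin n,
      ((j : ℕ) < k → x < -α j) ∧ (k ≤ j → -α j < x) := fun x hx j =>
    ⟨fun hj => hx.2.trans_lt ((hv j).1 hj), fun hj => (hu j hj).trans_le hx.1⟩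
  obtain ⟨x, hx, hxq⟩ := intermediate_value_Icc' huv.le
    ((continuousOn_mixExpPsi c σ η a α).mono fun x hx j => by
      rcases lt_or_ge (j : ℕ) k with h | h
      · exact ((hbetween x hx j).1 h).ne
      · exact ((hbetween x hx j).2 h).ne') ⟨hvq.le, huq.le⟩
  refine ⟨x, (hx.2.lt_of_ne ?_).trans_le hv0, hxq, hbetween x hx⟩
  rintro rfl
  exact hvq.ne hxq

open Polynomial in
/-- Clearing denominators in `ψ(l) - q` gives a polynomial of degree at most `n + 2`. -/
theorem exists_polynomial_eval_eq_mixExpPsi_sub_mul_prod {n : ℕ} (c σ η : ℝ)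
    (a α : Fin n → ℝ) (q : ℝ) :
    ∃ P : Polynomial ℝ, P.natDegree ≤ n + 2 ∧ ∀ l, (∀ j, l ≠ -α j) →
      P.eval l = (mixExpPsi n c σ η a α l - q) * ∏ j, (l + α j) := by
  have hprod : ∀ s : Finset (Fin n), (∏ j ∈ s, (X + C (α j))).natDegree ≤ n := fun s =>
    (natDegree_prod_le _ _).trans (by simpa using s.card_le_univ)
  refine ⟨(C (σ ^ 2 / 2) * X ^ 2 + C c * X + C (-η - q)) * ∏ j, (X + C (α j)) +
    C η * ∑ i, C (a i * α i) * ∏ j ∈ Finset.univ.erase i, (X + C (α j)), ?_, fun l hl => ?_⟩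
  · refine natDegree_add_le_of_degree_le ?_ ?_
    · exact natDegree_mul_le.trans
        ((add_le_add natDegree_quadratic_le (hprod _)).trans (add_comm _ _).le)
    · refine (natDegree_C_mul_le _ _).trans (natDegree_sum_le_of_forall_le _ _ fun i _ => ?_)
      exact (natDegree_C_mul_le _ _).trans ((hprod _).trans (Nat.le_add_right _ _))
  · have hsum : (∑ i, a i * α i / (l + α i)) * ∏ j, (l + α j) =
        ∑ i, a i * α i * ∏ j ∈ Finset.univ.erase i, (l + α j) := by
      rw [Finset.sum_mul]
      refine Finset.sum_congr rfl fun i _ => ?_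
      have hi : l + α i ≠ 0 := fun h => hl i (by linarith)
      rw [← Finset.mul_prod_erase _ _ (Finset.mem_univ i)]
      field_simp
    simp only [eval_add, eval_mul, eval_C, eval_X, eval_pow, eval_finsetSum, eval_prod, ← hsum,
      mixExpPsi]
    ring

/-- For every `q > 0`, the equation `ψ(λ) = q` has exactly `n+2` solutions
`θ₁ > θ₂ > ... > θ_{n+2}` in `ℝ ∖ {-α₁, ..., -αₙ}`, and these solutions interlace with the
poles of `ψ`:
`θ_{n+2} < -αₙ < θ_{n+1} < -α_{n-1} < θₙ < ... < θ₃ < -α₁ < θ₂ < θ₁`, with `θ₁ > 0`. -/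
theorem mixExpPsi_roots_interlace
    (n : ℕ) (hn : 1 ≤ n) (α a : Fin n → ℝ)
    (hαpos : ∀ i, 0 < α i) (hαmono : StrictMono α)
    (hapos : ∀ i, 0 < a i) (hasum : ∑ i, a i = 1)
    (η σ c : ℝ) (hη : 0 < η) (hσ : 0 < σ)
    (q : ℝ) (hq : 0 < q) :
    ∃ θ : Fin (n + 2) → ℝ,
      StrictAnti θ ∧ 0 < θ 0 ∧
      (∀ i, (∀ j, θ i ≠ -α j) ∧ mixExpPsi n c σ η a α (θ i) = q) ∧
      (∀ l : ℝ, (∀ j, l ≠ -α j) → mixExpPsi n c σ η a α l = q → ∃ i, θ i = l) ∧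
      (∀ i : Fin n, θ i.succ.succ < -α i ∧ -α i < θ i.castSucc.succ) := by
  have hψ0 : mixExpPsi n c σ η a α 0 < q := by
    rwa [mixExpPsi_zero hαpos hasum]
  have hpos : ∀ j, (0 : ℝ) ≠ -α j := fun j => by linarith [hαpos j]
  obtain ⟨x₀, hx₀, hx₀q⟩ : ∃ x, 0 < x ∧ mixExpPsi n c σ η a α x = q := by
    obtain ⟨v, hv, hv0⟩ := ((tendsto_mixExpPsi_atTop c η a α hσ).eventually_gt_atTop q |>.and
      (eventually_gt_atTop 0)).exists
    obtain ⟨x, hx, hxq⟩ := intermediate_value_Icc hv0.le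
      ((continuousOn_mixExpPsi c σ η a α).mono fun x hx j h => by
        linarith [hαpos j, hx.1]) ⟨hψ0.le, hv.le⟩
    refine ⟨x, hx.1.lt_of_ne ?_, hxq⟩
    rintro rfl
    exact hψ0.ne hxq
  choose y hy hyq hyα using fun k : Fin (n + 1) =>
    exists_neg_root_mixExpPsi_between c hαpos hαmono hapos hasum hη hσ hq
      (Nat.lt_succ_iff.mp k.2)
  have hanti : StrictAnti (Fin.cons x₀ y : Fin (n + 2) → ℝ) := by
    refine Fin.strictAnti_iff_succ_lt.mpr fun k => ?_
    refine Fin.cases ?_ (fun i => ?_) k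
    · simpa using (hy 0).trans hx₀
    · rw [← Fin.succ_castSucc, Fin.cons_succ, Fin.cons_succ]
      exact ((hyα i.succ i).1 (by simp)).trans ((hyα i.castSucc i).2 (by simp))
  have hroot : ∀ i, (∀ j, (Fin.cons x₀ y : Fin (n + 2) → ℝ) i ≠ -α j) ∧
      mixExpPsi n c σ η a α ((Fin.cons x₀ y : Fin (n + 2) → ℝ) i) = q := by
    refine Fin.cases ⟨fun j => ?_, by simpa using hx₀q⟩ fun k => ⟨fun j => ?_, by simpa using hyq k⟩
    · rw [Fin.cons_zero]
      linarith [hαpos j]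
    · rw [Fin.cons_succ]
      rcases lt_or_ge (j : ℕ) k with h | h
      · exact ((hyα k j).1 h).ne
      · exact ((hyα k j).2 h).ne'
  refine ⟨Fin.cons x₀ y, hanti, hx₀, hroot, fun l hl hlq => ?_, fun i => ⟨?_, ?_⟩⟩
  · obtain ⟨P, hPdeg, hP⟩ := exists_polynomial_eval_eq_mixExpPsi_sub_mul_prod c σ η a α q
    have hP0 : P ≠ 0 := by
      rintro rfl
      have h := hP 0 hpos
      rw [Polynomial.eval_zero, eq_comm, mul_eq_zero, Finset.prod_eq_zero_iff] at h
      rcases h with h | ⟨j, -, h⟩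
      · linarith
      · linarith [hαpos j]
    have hmem : ∀ x, (∀ j, x ≠ -α j) → mixExpPsi n c σ η a α x = q → x ∈ P.roots.toFinset :=
      fun x hx hxq => by simp [hP0, hP x hx, hxq]
    have heq : Finset.univ.image (Fin.cons x₀ y : Fin (n + 2) → ℝ) = P.roots.toFinset := by
      refine Finset.eq_of_subset_of_card_le ?_ ?_
      · intro x hx
        obtain ⟨i, -, rfl⟩ := Finset.mem_image.mp hx
        exact hmem _ (hroot i).1 (hroot i).2
      · rw [Finset.card_image_of_injective _ hanti.injective, Finset.card_fin]
        exact (Multiset.toFinset_card_le _).trans ((P.card_roots').trans hPdeg)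
    have hl' := hmem l hl hlq
    rw [← heq, Finset.mem_image] at hl'
    obtain ⟨i, -, hi⟩ := hl'
    exact ⟨i, hi⟩
  · rw [Fin.cons_succ]
    exact (hyα i.succ i).1 (by simp)
  · rw [Fin.cons_succ]
    exact (hyα i.castSucc i).2 (by simp)
end

section
/- Let q > 0 and let θ₁ > θ₂ > ... > θ_{n+2} be n+2 distinct real numbers in ℝ ∖ {−α₁, ..., −αₙ} with ψ(θᵢ) = q for each i. Then ψ′(θᵢ) ≠ 0 for each i; for every λ ∈ ℝ ∖ ({θ₁, ..., θ_{n+2}} ∪ {−α₁, ..., −αₙ}), 1/(ψ(λ) − q) = Σᵢ₌₁^{n+2} 1/( ψ′(θᵢ)(λ − θᵢ) ); and consequently, for every λ > θ₁, ∫₀^∞ e^{−λx} ( Σᵢ₌₁^{n+2} e^{θᵢ x}/ψ′(θᵢ) ) dx = 1/(ψ(λ) − q). -/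
open MeasureTheory Set Filter Topology

open Polynomial Lagrange

/-- The polynomial `(ψ(X) - q) ∏ⱼ (X + αⱼ)` obtained by clearing the denominators of `ψ - q`,
with its leading part split off. -/
noncomputable def mixExpNumerator (n : ℕ) (c σ η q : ℝ) (a α : Fin n → ℝ) : ℝ[X] :=
  C (σ ^ 2 / 2) * (X ^ 2 * nodal Finset.univ (-α)) +
    ((C c * X - C (η + q)) * nodal Finset.univ (-α) +
      ∑ i, C (η * (a i * α i)) * nodal (Finset.univ.erase i) (-α))

section

variable {n : ℕ} {c σ η q : ℝ} {a α : Fin n → ℝ}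

theorem eval_mixExpNumerator {l : ℝ} (hl : ∀ j, l ≠ -α j) :
    (mixExpNumerator n c σ η q a α).eval l =
      (mixExpPsi n c σ η a α l - q) * (nodal Finset.univ (-α)).eval l := by
  have hsum : (∑ i, a i * α i / (l + α i)) * (nodal Finset.univ (-α)).eval l =
      ∑ i, a i * α i * (nodal (Finset.univ.erase i) (-α)).eval l := by
    rw [Finset.sum_mul]
    refine Finset.sum_congr rfl fun i _ => ?_
    have hi : l + α i ≠ 0 := fun h => hl i (by linarith)
    rw [nodal_eq_mul_nodal_erase (Finset.mem_univ i)]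
    simp only [eval_mul, eval_sub, eval_X, eval_C, Pi.neg_apply, sub_neg_eq_add]
    field_simp
  simp only [mixExpNumerator, mixExpPsi, eval_add, eval_sub, eval_mul, eval_pow, eval_X, eval_C,
    eval_finsetSum, mul_assoc η, ← Finset.mul_sum, ← hsum]
  ring

theorem degree_mixExpNumerator_leading (hσ : 0 < σ) :
    (C (σ ^ 2 / 2) * (X ^ 2 * nodal Finset.univ (-α))).degree = ((n + 2 : ℕ) : WithBot ℕ) := by
  rw [degree_C_mul (by positivity), degree_mul, degree_X_pow, degree_nodal, Finset.card_fin]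
  norm_cast
  rw [add_comm]

theorem degree_mixExpNumerator_remainder_lt :
    ((C c * X - C (η + q)) * nodal Finset.univ (-α) +
      ∑ i, C (η * (a i * α i)) * nodal (Finset.univ.erase i) (-α)).degree <
        ((n + 2 : ℕ) : WithBot ℕ) := by
  have hlin : (C c * X - C (η + q)).degree ≤ 1 := by
    rw [sub_eq_add_neg, ← C_neg]
    exact degree_linear_le
  have hmul : ((C c * X - C (η + q)) * nodal Finset.univ (-α)).degree ≤
      ((n + 1 : ℕ) : WithBot ℕ) := by
    rw [degree_mul, degree_nodal, Finset.card_fin, Nat.add_comm n 1, Nat.cast_add, Nat.cast_one]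
    gcongr
  have hsum : (∑ i, C (η * (a i * α i)) * nodal (Finset.univ.erase i) (-α)).degree ≤
      ((n + 1 : ℕ) : WithBot ℕ) := by
    refine (degree_sum_le _ _).trans (Finset.sup_le fun i _ => ?_)
    rw [← smul_eq_C_mul]
    refine (degree_smul_le _ _).trans ?_
    rw [degree_nodal]
    have := Finset.card_le_univ (Finset.univ.erase i)
    rw [Fintype.card_fin] at this
    exact_mod_cast this.trans n.le_succ
  refine ((degree_add_le _ _).trans (max_le hmul hsum)).trans_lt ?_
  exact_mod_cast Nat.lt_succ_self _

theorem mixExpNumerator_eq_mul_nodal (hσ : 0 < σ) {θ : Fin (n + 2) → ℝ}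
    (hinj : Function.Injective θ)
    (hθ : ∀ i, (∀ j, θ i ≠ -α j) ∧ mixExpPsi n c σ η a α (θ i) = q) :
    mixExpNumerator n c σ η q a α = C (σ ^ 2 / 2) * nodal Finset.univ θ := by
  have hk : σ ^ 2 / 2 ≠ 0 := by positivity
  have hlt : ((C c * X - C (η + q)) * nodal Finset.univ (-α) +
      ∑ i, C (η * (a i * α i)) * nodal (Finset.univ.erase i) (-α)).degree <
        (C (σ ^ 2 / 2) * (X ^ 2 * nodal Finset.univ (-α))).degree := by
    rw [degree_mixExpNumerator_leading hσ]
    exact degree_mixExpNumerator_remainder_lt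
  have hdeg : (mixExpNumerator n c σ η q a α).degree = ((n + 2 : ℕ) : WithBot ℕ) := by
    rw [mixExpNumerator, degree_add_eq_left_of_degree_lt hlt, degree_mixExpNumerator_leading hσ]
  have hlead : (mixExpNumerator n c σ η q a α).leadingCoeff = σ ^ 2 / 2 := by
    rw [mixExpNumerator, leadingCoeff_add_of_degree_lt' hlt, leadingCoeff_mul, leadingCoeff_C,
      ((monic_X_pow 2).mul nodal_monic).leadingCoeff, mul_one]
  refine eq_of_degree_le_of_eval_index_eq (s := Finset.univ) (v := θ) hinj.injOn ?_ ?_ ?_ ?_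
  · rw [hdeg, Finset.card_fin]
  · rw [hdeg, degree_C_mul hk, degree_nodal, Finset.card_fin]
  · rw [hlead, leadingCoeff_mul, leadingCoeff_C, nodal_monic.leadingCoeff, mul_one]
  · intro i hi
    rw [eval_mixExpNumerator (hθ i).1, (hθ i).2, sub_self, zero_mul, eval_mul,
      eval_nodal_at_node hi, mul_zero]

theorem eval_nodal_neg_ne_zero {l : ℝ} (hl : ∀ j, l ≠ -α j) :
    (nodal Finset.univ (-α)).eval l ≠ 0 :=
  eval_nodal_not_at_node fun j _ => hl j

theorem mixExpPsi_sub_eq (hσ : 0 < σ) {θ : Fin (n + 2) → ℝ} (hinj : Function.Injective θ)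
    (hθ : ∀ i, (∀ j, θ i ≠ -α j) ∧ mixExpPsi n c σ η a α (θ i) = q)
    {l : ℝ} (hl : ∀ j, l ≠ -α j) :
    mixExpPsi n c σ η a α l - q =
      (C (σ ^ 2 / 2) * nodal Finset.univ θ).eval l / (nodal Finset.univ (-α)).eval l := by
  rw [eq_div_iff (eval_nodal_neg_ne_zero hl), ← eval_mixExpNumerator hl,
    mixExpNumerator_eq_mul_nodal hσ hinj hθ]

theorem deriv_mixExpPsi_root (hσ : 0 < σ) {θ : Fin (n + 2) → ℝ} (hinj : Function.Injective θ)
    (hθ : ∀ i, (∀ j, θ i ≠ -α j) ∧ mixExpPsi n c σ η a α (θ i) = q) (i : Fin (n + 2)) :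
    deriv (mixExpPsi n c σ η a α) (θ i) =
      σ ^ 2 / 2 * (nodalWeight Finset.univ θ i)⁻¹ / (nodal Finset.univ (-α)).eval (θ i) := by
  have hQ := eval_nodal_neg_ne_zero (hθ i).1
  have hev : mixExpPsi n c σ η a α =ᶠ[𝓝 (θ i)] fun l =>
      (C (σ ^ 2 / 2) * nodal Finset.univ θ).eval l / (nodal Finset.univ (-α)).eval l + q := by
    have : ∀ᶠ l in 𝓝 (θ i), ∀ j, l ≠ -α j :=
      eventually_all.2 fun j => eventually_ne_nhds ((hθ i).1 j)
    filter_upwards [this] with l hl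
    rw [← mixExpPsi_sub_eq hσ hinj hθ hl, sub_add_cancel]
  have hder := (((C (σ ^ 2 / 2) * nodal Finset.univ θ).hasDerivAt (θ i)).fun_div
    ((nodal Finset.univ (-α)).hasDerivAt (θ i)) hQ).add_const q
  rw [hev.deriv_eq, hder.deriv, nodalWeight_eq_eval_derivative_nodal (Finset.mem_univ i), inv_inv]
  simp only [derivative_mul, derivative_C, zero_mul, zero_add, eval_mul, eval_C,
    eval_nodal_at_node (Finset.mem_univ i), mul_zero, sub_zero]
  field_simp

theorem one_div_mixExpPsi_sub (hσ : 0 < σ) {θ : Fin (n + 2) → ℝ} (hinj : Function.Injective θ)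
    (hθ : ∀ i, (∀ j, θ i ≠ -α j) ∧ mixExpPsi n c σ η a α (θ i) = q)
    {l : ℝ} (hlθ : ∀ i, l ≠ θ i) (hl : ∀ j, l ≠ -α j) :
    1 / (mixExpPsi n c σ η a α l - q) =
      ∑ i, 1 / (deriv (mixExpPsi n c σ η a α) (θ i) * (l - θ i)) := by
  have hdeg : (nodal Finset.univ (-α)).degree < (Finset.univ : Finset (Fin (n + 2))).card := by
    rw [degree_nodal, Finset.card_fin, Finset.card_fin]
    exact_mod_cast Nat.lt_add_of_pos_right two_pos
  have hnod : (nodal Finset.univ θ).eval l ≠ 0 := eval_nodal_not_at_node fun i _ => hlθ i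
  have hinterp : (nodal Finset.univ (-α)).eval l = (nodal Finset.univ θ).eval l *
      ∑ i, nodalWeight Finset.univ θ i * (l - θ i)⁻¹ * (nodal Finset.univ (-α)).eval (θ i) := by
    conv_lhs => rw [eq_interpolate hinj.injOn hdeg]
    exact eval_interpolate_not_at_node _ fun i _ => hlθ i
  rw [mixExpPsi_sub_eq hσ hinj hθ hl, one_div_div, eval_mul, eval_C, hinterp, mul_comm (σ ^ 2 / 2),
    mul_div_mul_left _ _ hnod, Finset.sum_div]
  refine Finset.sum_congr rfl fun i _ => ?_
  have hw := nodalWeight_ne_zero hinj.injOn (Finset.mem_univ i)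
  have hQ := eval_nodal_neg_ne_zero (hθ i).1
  have hli : l - θ i ≠ 0 := sub_ne_zero.2 (hlθ i)
  rw [deriv_mixExpPsi_root hσ hinj hθ]
  field_simp

theorem exists_mixExpPsi_root_pos (hαpos : ∀ i, 0 < α i) (hasum : ∑ i, a i = 1)
    (hσ : 0 < σ) (hq : 0 < q) {θ : Fin (n + 2) → ℝ} (hinj : Function.Injective θ)
    (hθ : ∀ i, (∀ j, θ i ≠ -α j) ∧ mixExpPsi n c σ η a α (θ i) = q) :
    ∃ i, 0 < θ i := by
  by_contra! hle
  have hψ : mixExpPsi n c σ η a α 0 = 0 := by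
    have : ∑ i, a i * α i / (0 + α i) = 1 := by
      rw [← hasum]
      refine Finset.sum_congr rfl fun i _ => ?_
      rw [zero_add, mul_div_cancel_right₀ _ (hαpos i).ne']
    rw [mixExpPsi, this]
    ring
  have heq := mixExpPsi_sub_eq hσ hinj hθ (l := 0) fun j => by
    simpa using (hαpos j).ne'
  have hnum : 0 ≤ (C (σ ^ 2 / 2) * nodal Finset.univ θ).eval 0 := by
    rw [eval_mul, eval_C, eval_nodal]
    exact mul_nonneg (by positivity) (Finset.prod_nonneg fun i _ => by linarith [hle i])
  have hden : 0 ≤ (nodal Finset.univ (-α)).eval 0 := by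
    rw [eval_nodal]
    exact Finset.prod_nonneg fun i _ => by simpa using (hαpos i).le
  have := div_nonneg hnum hden
  rw [← heq, hψ] at this
  linarith

end

theorem integral_exp_neg_mul_sum_exp {ι : Type*} [Fintype ι] (θ d : ι → ℝ) {l : ℝ}
    (hl : ∀ i, θ i < l) :
    ∫ x in Set.Ioi (0 : ℝ), Real.exp (-l * x) * ∑ i, Real.exp (θ i * x) / d i =
      ∑ i, 1 / (d i * (l - θ i)) := by
  have hfun : (fun x : ℝ => Real.exp (-l * x) * ∑ i, Real.exp (θ i * x) / d i) =
      fun x => ∑ i, Real.exp ((θ i - l) * x) / d i := by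
    ext x
    rw [Finset.mul_sum]
    refine Finset.sum_congr rfl fun i _ => ?_
    rw [← mul_div_assoc, ← Real.exp_add]
    ring_nf
  rw [hfun, integral_finsetSum _ fun i _ =>
    (integrableOn_exp_mul_Ioi (sub_neg.2 (hl i)) 0).div_const (d i)]
  refine Finset.sum_congr rfl fun i _ => ?_
  rw [integral_div, integral_exp_mul_Ioi (sub_neg.2 (hl i)), mul_zero, Real.exp_zero,
    ← neg_sub l, neg_div_neg_eq, div_div, mul_comm]

/-- Let `q > 0` and let `θ₁ > ... > θ_{n+2}` be `n+2` distinct reals outside the poles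
with `ψ(θᵢ) = q`. Then `ψ′(θᵢ) ≠ 0` for each `i`; the partial fraction decomposition
`1/(ψ(λ) - q) = Σᵢ 1/(ψ′(θᵢ)(λ - θᵢ))` holds away from the roots and poles; and for every
`λ > θ₁`, `∫₀^∞ e^{-λx} Σᵢ e^{θᵢx}/ψ′(θᵢ) dx = 1/(ψ(λ) - q)`. -/
theorem mixExpPsi_partial_fractions
    (n : ℕ) (hn : 1 ≤ n) (α a : Fin n → ℝ)
    (hαpos : ∀ i, 0 < α i) (hαmono : StrictMono α)
    (hapos : ∀ i, 0 < a i) (hasum : ∑ i, a i = 1)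
    (η σ c : ℝ) (hη : 0 < η) (hσ : 0 < σ)
    (q : ℝ) (hq : 0 < q)
    (θ : Fin (n + 2) → ℝ) (hθanti : StrictAnti θ)
    (hθ : ∀ i, (∀ j, θ i ≠ -α j) ∧ mixExpPsi n c σ η a α (θ i) = q) :
    (∀ i, deriv (mixExpPsi n c σ η a α) (θ i) ≠ 0) ∧
    (∀ l : ℝ, (∀ i, l ≠ θ i) → (∀ j, l ≠ -α j) →
      1 / (mixExpPsi n c σ η a α l - q) =
        ∑ i, 1 / (deriv (mixExpPsi n c σ η a α) (θ i) * (l - θ i))) ∧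
    (∀ l : ℝ, θ 0 < l →
      (∫ x in Set.Ioi (0 : ℝ),
          Real.exp (-l * x) *
            ∑ i, Real.exp (θ i * x) / deriv (mixExpPsi n c σ η a α) (θ i)) =
        1 / (mixExpPsi n c σ η a α l - q)) := by
  have hinj := hθanti.injective
  refine ⟨fun i => ?_, fun l hlθ hl => one_div_mixExpPsi_sub hσ hinj hθ hlθ hl, fun l hl => ?_⟩
  · rw [deriv_mixExpPsi_root hσ hinj hθ]
    have hw := nodalWeight_ne_zero hinj.injOn (Finset.mem_univ i)
    have hQ := eval_nodal_neg_ne_zero (hθ i).1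
    positivity
  · have hlt : ∀ i, θ i < l := fun i => (hθanti.antitone (Fin.zero_le i)).trans_lt hl
    obtain ⟨i, hi⟩ := exists_mixExpPsi_root_pos hαpos hasum hσ hq hinj hθ
    rw [integral_exp_neg_mul_sum_exp θ _ hlt, one_div_mixExpPsi_sub hσ hinj hθ
      (fun i => (hlt i).ne') fun j => (((neg_neg_of_pos (hαpos j)).trans hi).trans (hlt i)).ne']
end
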